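/- Every complex eigenvalue of the inverse matrix F_0^{−1} is real and lies in the half-open interval (η^{−1}, δ^{−1}]. -/

import Mathlib

/-- The reduced Maxwell–Stefan matrix `F₀` with entries
`[F₀] i j = -(k i j - k i n) * c i` for `i ≠ j` and
`[F₀] i i = ∑_{j ≠ i, j ≤ n-1} (k i j - k i n) * c j + c_tot * k i n`,
where `c_tot = ∑ r, c r`. The number of species is `m + 1` (the paper's `n`),
and the paper's index `n` is `Fin.last m`. -/
def MSmatF0 (m : ℕ) (k : Fin (m + 1) → Fin (m + 1) → ℝ)
    (c : Fin (m + 1) → ℝ) : Matrix (Fin m) (Fin m) ℝ :=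
  Matrix.of fun i j =>
    if i = j then
      (∑ j' ∈ Finset.univ.erase i,
          (k i.castSucc j'.castSucc - k i.castSucc (Fin.last m)) * c j'.castSucc)
        + (∑ r, c r) * k i.castSucc (Fin.last m)
    else -((k i.castSucc j.castSucc - k i.castSucc (Fin.last m)) * c i.castSucc)

open Finset in
/-- A complex eigenvalue of the Maxwell–Stefan operator
`x ↦ (∑ j, a i j * (c j * x i - c i * x j))ᵢ` on the vectors of zero sum is real,
bounded below by the weights and above by the row sums. -/
lemma maxwellStefan_eigenvalue_real {ι : Type*} [Fintype ι]
    (a : ι → ι → ℝ) (c : ι → ℝ) (d M : ℝ) (ha : ∀ i j, a i j = a j i)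
    (ha0 : ∀ i j, 0 ≤ a i j) (hd : ∀ i j, i ≠ j → d ≤ a i j) (hc : ∀ i, 0 ≤ c i)
    (hM : ∀ i, ∑ j, a i j * c j < M) (x : ι → ℂ) (hx : x ≠ 0) (hsum : ∑ i, x i = 0) (z : ℂ)
    (hz : ∀ i, ∑ j, (a i j : ℂ) * (c j * x i - c i * x j) = z * x i) :
    ∃ r : ℝ, z = r ∧ d * ∑ i, c i ≤ r ∧ r < 2 * M := by
  by_cases h : ∃ i, c i = 0 ∧ x i ≠ 0
  · obtain ⟨i, hci, hxi⟩ := h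
    refine ⟨∑ j, a i j * c j, ?_, ?_, ?_⟩
    · apply mul_right_cancel₀ hxi
      rw [← hz i, hci]
      push_cast
      rw [sum_mul]
      exact sum_congr rfl fun j _ => by ring
    · rw [mul_sum]
      refine sum_le_sum fun j _ => ?_
      rcases eq_or_ne i j with rfl | hij
      · simp [hci]
      · exact mul_le_mul_of_nonneg_right (hd i j hij) (hc j)
    · have h0 : 0 ≤ ∑ j, a i j * c j := sum_nonneg fun j _ => mul_nonneg (ha0 i j) (hc j)
      linarith [hM i]
  · push Not at h
    obtain ⟨y, hy⟩ : ∃ y : ι → ℂ, ∀ i, x i = c i * y i := by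
      refine ⟨fun i => x i / c i, fun i => ?_⟩
      by_cases hi : c i = 0
      · simp [hi, h i hi]
      · have : (c i : ℂ) ≠ 0 := by exact_mod_cast hi
        field_simp
    set q : ι → ℝ := fun i => Complex.normSq (y i) with hq
    set N : ℝ := ∑ i, c i * q i with hN
    set E : ℝ := ∑ i, ∑ j, a i j * (c i * c j) * Complex.normSq (y i - y j) with hE
    obtain ⟨i₀, hi₀⟩ : ∃ i, 0 < c i * q i := by
      obtain ⟨i, hi⟩ := Function.ne_iff.mp hx
      rw [hy i] at hi
      have hci : c i ≠ 0 := fun h => hi (by simp [h])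
      have hyi : y i ≠ 0 := fun h => hi (by simp [h])
      exact ⟨i, mul_pos ((hc i).lt_of_ne' hci) (Complex.normSq_pos.mpr hyi)⟩
    have hcq : ∀ i, 0 ≤ c i * q i := fun i => mul_nonneg (hc i) (Complex.normSq_nonneg _)
    have hNpos : 0 < N := sum_pos' (fun i _ => hcq i) ⟨i₀, mem_univ _, hi₀⟩
    have energy : z * (2 * N : ℝ) = (E : ℝ) := by
      have h1 : z * (N : ℂ) =
          ∑ i, ∑ j, (a i j : ℂ) * (c i * c j) * ((y i - y j) * (starRingEnd ℂ) (y i)) := by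
        simp only [hN, hq]
        push_cast
        rw [mul_sum]
        refine sum_congr rfl fun i _ => ?_
        rw [← Complex.mul_conj]
        have := congrArg (· * (starRingEnd ℂ) (y i)) (hz i)
        simp only [hy, sum_mul] at this
        calc _ = z * (c i * y i) * (starRingEnd ℂ) (y i) := by ring
          _ = _ := by
            rw [← this]
            exact sum_congr rfl fun j _ => by ring
      have h2 : z * (N : ℂ) =
          ∑ i, ∑ j, (a i j : ℂ) * (c i * c j) * ((y j - y i) * (starRingEnd ℂ) (y j)) := by
        rw [h1, sum_comm]
        refine sum_congr rfl fun i _ => sum_congr rfl fun j _ => ?_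
        rw [ha j i]
        ring
      have h3 : z * (2 * N : ℝ) = z * N + z * N := by push_cast; ring
      rw [h3]
      nth_rewrite 1 [h1]
      rw [h2, ← sum_add_distrib, hE]
      push_cast
      refine sum_congr rfl fun i _ => ?_
      rw [← sum_add_distrib]
      refine sum_congr rfl fun j _ => ?_
      rw [← Complex.mul_conj, map_sub]
      ring
    have hzr : z = ((E / (2 * N) : ℝ) : ℂ) := by
      have : ((2 * N : ℝ) : ℂ) ≠ 0 := by exact_mod_cast (by positivity)
      rw [Complex.ofReal_div, eq_div_iff this, energy]
    have hre : ∑ i, c i * (y i).re = 0 := by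
      simpa [hy] using congrArg Complex.re hsum
    have him : ∑ i, c i * (y i).im = 0 := by
      simpa [hy] using congrArg Complex.im hsum
    have variance : ∑ i, ∑ j, (c i * c j) * Complex.normSq (y i - y j) =
        2 * ((∑ i, c i) * N) := by
      have e : ∀ i j, (c i * c j) * Complex.normSq (y i - y j) =
          (c i * q i) * c j + c i * (c j * q j)
          - 2 * ((c i * (y i).re) * (c j * (y j).re))
          - 2 * ((c i * (y i).im) * (c j * (y j).im)) := by
        intro i j
        simp only [hq, Complex.normSq_apply, Complex.sub_re, Complex.sub_im]
        ring
      simp only [e, sum_add_distrib, sum_sub_distrib, ← mul_sum, ← sum_mul, hre, him]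
      ring
    refine ⟨E / (2 * N), hzr, ?_, ?_⟩
    · rw [le_div_iff₀ (by positivity)]
      calc _ = d * ∑ i, ∑ j, (c i * c j) * Complex.normSq (y i - y j) := by
            rw [variance]; ring
        _ ≤ E := by
          simp only [mul_sum, hE]
          refine sum_le_sum fun i _ => sum_le_sum fun j _ => ?_
          rcases eq_or_ne i j with rfl | hij
          · simp
          · rw [← mul_assoc]
            exact mul_le_mul_of_nonneg_right
              (mul_le_mul_of_nonneg_right (hd i j hij) (mul_nonneg (hc i) (hc j)))
              (Complex.normSq_nonneg _)
    · rw [div_lt_iff₀ (by positivity)]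
      calc E ≤ ∑ i, ∑ j, (2 * (c i * q i * (a i j * c j)) + 2 * (c j * q j * (a j i * c i))) := by
            refine sum_le_sum fun i _ => sum_le_sum fun j _ => ?_
            have hw : 0 ≤ a i j * (c i * c j) := mul_nonneg (ha0 i j) (mul_nonneg (hc i) (hc j))
            have hp : Complex.normSq (y i - y j) ≤ 2 * q i + 2 * q j := by
              simp only [hq, Complex.normSq_apply, Complex.sub_re, Complex.sub_im]
              nlinarith [sq_nonneg ((y i).re + (y j).re), sq_nonneg ((y i).im + (y j).im)]
            rw [ha j i]
            linarith [mul_le_mul_of_nonneg_left hp hw]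
        _ = 4 * ∑ i, c i * q i * ∑ j, a i j * c j := by
            simp only [sum_add_distrib]
            rw [sum_comm (f := fun i j => 2 * (c j * q j * (a j i * c i)))]
            simp only [← mul_sum]
            ring
        _ < 4 * ∑ i, c i * q i * M := by
            refine mul_lt_mul_of_pos_left (sum_lt_sum (fun i _ => ?_) ⟨i₀, mem_univ _, ?_⟩)
              (by norm_num)
            · exact mul_le_mul_of_nonneg_left (hM i).le (hcq i)
            · exact mul_lt_mul_of_pos_left (hM i₀) hi₀
        _ = 2 * M * (2 * N) := by
            rw [← sum_mul]
            ring

lemma MSmatF0_apply (m : ℕ) (k : Fin (m + 1) → Fin (m + 1) → ℝ) (c : Fin (m + 1) → ℝ)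
    (i j : Fin m) :
    MSmatF0 m k c i j =
      (if i = j then ∑ l, k i.castSucc l * c l else 0)
        - (k i.castSucc j.castSucc - k i.castSucc (Fin.last m)) * c i.castSucc := by
  unfold MSmatF0
  rw [Matrix.of_apply]
  split_ifs with h
  · subst h
    rw [Finset.sum_erase_eq_sub (Finset.mem_univ i)]
    simp only [Fin.sum_univ_castSucc, sub_mul, Finset.sum_sub_distrib, ← Finset.mul_sum]
    ring
  · ring

open Finset in
/-- An eigenvector of `F₀` extends to a zero-sum eigenvector of the full
Maxwell–Stefan operator. -/
lemma MSmatF0_eigenvector_extend (m : ℕ) (k : Fin (m + 1) → Fin (m + 1) → ℝ)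
    (hsymm : ∀ i j, k i j = k j i) (c : Fin (m + 1) → ℝ) (v : Fin m → ℂ) (z : ℂ)
    (hv : ((MSmatF0 m k c).map Complex.ofReal).mulVec v = z • v) :
    ∃ x : Fin (m + 1) → ℂ, (∀ i : Fin m, x i.castSucc = v i) ∧ ∑ i, x i = 0 ∧
      ∀ i, ∑ j, (k i j : ℂ) * (c j * x i - c i * x j) = z * x i := by
  set x : Fin (m + 1) → ℂ := Fin.snoc v (-∑ i, v i) with hxdef
  have hx : ∀ i : Fin m, x i.castSucc = v i := fun i => by simp [hxdef]
  have hlast : x (Fin.last m) = -∑ i, v i := by simp [hxdef]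
  have hsum : ∑ i, x i = 0 := by simp [Fin.sum_univ_castSucc, hx, hlast]
  have hcast : ∀ i : Fin m, ∑ j, (k i.castSucc j : ℂ) * (c j * x i.castSucc - c i.castSucc * x j)
      = z * x i.castSucc := by
    intro i
    have h := congrFun hv i
    simp only [Matrix.mulVec, dotProduct, Matrix.map_apply, MSmatF0_apply, Pi.smul_apply,
      smul_eq_mul] at h
    rw [hx, ← h, Fin.sum_univ_castSucc]
    simp only [hx, hlast]
    simp only [Complex.ofReal_sub, Complex.ofReal_mul, apply_ite Complex.ofReal,
      Complex.ofReal_zero, sub_mul, mul_sub, ite_mul, zero_mul, sum_sub_distrib, sum_ite_eq,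
      mem_univ, if_true, Fin.sum_univ_castSucc, Complex.ofReal_add, Complex.ofReal_sum, add_mul,
      sum_mul, mul_sum, mul_neg, mul_assoc]
    ring
  have hanti : ∑ i, ∑ j, (k i j : ℂ) * (c j * x i - c i * x j) = 0 := by
    have h : ∑ i, ∑ j, (k i j : ℂ) * (c j * x i - c i * x j)
        = -∑ i, ∑ j, (k i j : ℂ) * (c j * x i - c i * x j) := by
      conv_lhs => rw [sum_comm]
      simp only [← sum_neg_distrib]
      refine sum_congr rfl fun i _ => sum_congr rfl fun j _ => ?_
      rw [hsymm j i]
      ring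
    exact self_eq_neg.mp h
  refine ⟨x, hx, hsum, Fin.lastCases ?_ hcast⟩
  rw [Fin.sum_univ_castSucc] at hanti hsum
  rw [sum_congr rfl fun i _ => hcast i, ← mul_sum] at hanti
  linear_combination hanti - z * hsum

/-- every complex eigenvalue of the inverse matrix `F₀⁻¹` is real
and lies in the half-open interval `(η⁻¹, δ⁻¹]`, where `δ = c_min · min_{i ≠ j} k i j`
and `η = 2 c_max ∑_{i ≠ j} k i j`. -/
theorem spectrum_F0_inv
    (m : ℕ) (hm : 1 ≤ m)
    (k : Fin (m + 1) → Fin (m + 1) → ℝ)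
    (hsymm : ∀ i j, k i j = k j i)
    (hkpos : ∀ i j, i ≠ j → 0 < k i j)
    (c : Fin (m + 1) → ℝ)
    (hc : ∀ i, 0 ≤ c i)
    (cmin cmax : ℝ)
    (hcmin : 0 < cmin)
    (hmin : cmin ≤ ∑ i, c i)
    (hmax : ∑ i, c i ≤ cmax)
    (δ₀ : ℝ)
    (hδ₀ : IsLeast {x : ℝ | ∃ i j : Fin (m + 1), i ≠ j ∧ k i j = x} δ₀)
    (δ η : ℝ)
    (hδ : δ = cmin * δ₀)
    (hη : η = 2 * cmax * ∑ i : Fin (m + 1), ∑ j ∈ Finset.univ.erase i, k i j) :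
    ∀ μ ∈ spectrum ℂ (((MSmatF0 m k c)⁻¹).map Complex.ofReal),
      μ.im = 0 ∧ η⁻¹ < μ.re ∧ μ.re ≤ δ⁻¹ := by
  classical
  set a : Fin (m + 1) → Fin (m + 1) → ℝ := fun i j => if i = j then 0 else k i j with ha
  have hane : ∀ i j, i ≠ j → a i j = k i j := fun i j h => by simp [ha, h]
  have ha0 : ∀ i j, 0 ≤ a i j := by
    intro i j
    rcases eq_or_ne i j with rfl | h
    · simp [ha]
    · exact hane i j h ▸ (hkpos i j h).le
  have hasymm : ∀ i j, a i j = a j i := by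
    intro i j
    simp only [ha, hsymm i j, eq_comm]
  have hrow : ∀ i, ∑ j ∈ Finset.univ.erase i, k i j = ∑ j, a i j := by
    intro i
    rw [← Finset.sum_erase_add _ _ (Finset.mem_univ i)]
    have : a i i = 0 := by simp [ha]
    rw [this, add_zero]
    exact Finset.sum_congr rfl fun j hj => (hane i j (Finset.ne_of_mem_erase hj).symm).symm
  have hδ₀pos : 0 < δ₀ := by
    obtain ⟨i, j, hij, h⟩ := hδ₀.1
    exact h ▸ hkpos i j hij
  have hδpos : 0 < δ := hδ ▸ mul_pos hcmin hδ₀pos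
  have hcmax : 0 < cmax := hcmin.trans_le (hmin.trans hmax)
  have hM : ∀ i, ∑ j, a i j * c j < cmax * ∑ i, ∑ j, a i j := by
    intro i
    have : Nontrivial (Fin (m + 1)) := Fin.nontrivial_iff_two_le.mpr (by omega)
    obtain ⟨l, hl⟩ := exists_ne i
    have hnn : ∀ i, 0 ≤ ∑ j, a i j := fun i => Finset.sum_nonneg fun j _ => ha0 i j
    have hlpos : 0 < ∑ j, a l j := Finset.sum_pos' (fun j _ => ha0 l j)
      ⟨i, Finset.mem_univ _, hane l i hl ▸ hkpos l i hl⟩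
    calc ∑ j, a i j * c j ≤ ∑ j, a i j * cmax := Finset.sum_le_sum fun j _ =>
          mul_le_mul_of_nonneg_left
            ((Finset.single_le_sum (fun r _ => hc r) (Finset.mem_univ j)).trans hmax) (ha0 i j)
      _ = cmax * ∑ j, a i j := by rw [← Finset.sum_mul, mul_comm]
      _ < _ := mul_lt_mul_of_pos_left
          (Finset.single_lt_sum (f := fun i => ∑ j, a i j) hl (Finset.mem_univ i) (Finset.mem_univ l) hlpos
            fun r _ _ => hnn r) hcmax
  set A : Matrix (Fin m) (Fin m) ℂ := (MSmatF0 m k c).map Complex.ofReal with hA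
  have key : ∀ (v : Fin m → ℂ) (z : ℂ), v ≠ 0 → A.mulVec v = z • v →
      ∃ r : ℝ, z = r ∧ δ ≤ r ∧ r < η := by
    intro v z hv hAv
    obtain ⟨x, hxv, hsum, hx⟩ := MSmatF0_eigenvector_extend m k hsymm c v z hAv
    have hx0 : x ≠ 0 := by
      rintro rfl
      exact hv (funext fun i => (hxv i).symm)
    obtain ⟨r, hr, h1, h2⟩ := maxwellStefan_eigenvalue_real a c δ₀ _ hasymm ha0
      (fun i j h => hane i j h ▸ hδ₀.2 ⟨i, j, h, rfl⟩) hc hM x hx0 hsum z (by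
        intro i
        rw [← hx i]
        refine Finset.sum_congr rfl fun j _ => ?_
        rcases eq_or_ne i j with rfl | h
        · simp
        · rw [hane i j h])
    refine ⟨r, hr, ?_, ?_⟩
    · rw [hδ, mul_comm]
      exact (mul_le_mul_of_nonneg_left hmin hδ₀pos.le).trans h1
    · simp only [hη, hrow]
      linarith
  have hdetA : A.det ≠ 0 := by
    intro h
    obtain ⟨v, hv, hv0⟩ := Matrix.exists_mulVec_eq_zero_iff.mpr h
    obtain ⟨r, hr, h1, -⟩ := key v 0 hv (by simpa using hv0)
    have : r = 0 := by exact_mod_cast hr.symm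
    linarith
  have hdet : IsUnit (MSmatF0 m k c).det := by
    have h : A.det = ((MSmatF0 m k c).det : ℂ) :=
      (RingHom.map_det Complex.ofRealHom (MSmatF0 m k c)).symm
    rw [isUnit_iff_ne_zero]
    rintro h0
    exact hdetA (by rw [h, h0, Complex.ofReal_zero])
  have hAinv : A * ((MSmatF0 m k c)⁻¹).map Complex.ofReal = 1 := by
    have h := Matrix.map_mul (L := MSmatF0 m k c) (M := (MSmatF0 m k c)⁻¹)
      (f := Complex.ofRealHom)
    rw [Matrix.mul_nonsing_inv _ hdet, Matrix.map_one _ (map_zero _) (map_one _)] at h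
    exact h.symm
  intro μ hμ
  rw [← Matrix.spectrum_toLin', ← Module.End.hasEigenvalue_iff_mem_spectrum] at hμ
  obtain ⟨v, hv⟩ := hμ.exists_hasEigenvector
  have hBv := hv.apply_eq_smul
  rw [Matrix.toLin'_apply] at hBv
  have hvA : μ • A.mulVec v = v := by
    rw [← Matrix.mulVec_smul, ← hBv, Matrix.mulVec_mulVec, hAinv, Matrix.one_mulVec]
  have hμ0 : μ ≠ 0 := by
    rintro rfl
    exact hv.2 (by rw [← hvA, zero_smul])
  obtain ⟨r, hr, h1, h2⟩ := key v μ⁻¹ hv.2 (by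
    nth_rewrite 2 [← hvA]
    rw [smul_smul, inv_mul_cancel₀ hμ0, one_smul])
  have hrpos : 0 < r := hδpos.trans_le h1
  have hμr : μ = ((r⁻¹ : ℝ) : ℂ) := by
    rw [Complex.ofReal_inv, ← hr, inv_inv]
  rw [hμr, Complex.ofReal_im, Complex.ofReal_re]
  exact ⟨rfl, inv_strictAnti₀ hrpos h2, inv_anti₀ hδpos h1⟩
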